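/- Let f be a polynomial in ℝ[x₁,…,xₙ]. For every isolated point x ∈ 𝒵(f), every i ∈ {1,…,n}, and every polynomial g ∈ I_i ∩ ℝ[x₁,…,xₙ], one has g(x) = 0. Consequently, 𝒵(f) is contained in the set of real common zeros of the ideal ⟨f⟩ + Σ_{i=1}^n (I_i ∩ ℝ[x₁,…,xₙ]) of ℝ[x₁,…,xₙ]. -/

import Mathlib

open MvPolynomial Metric

lemma aux_hasDerivAt {n : ℕ} (i : Fin n) (y : Fin n → ℝ) (p : MvPolynomial (Fin n) ℝ) (s : ℝ) :
    HasDerivAt (fun s : ℝ => MvPolynomial.eval (y + Pi.single i s) p)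
      (MvPolynomial.eval (y + Pi.single i s) (pderiv i p)) s := by
  induction p using MvPolynomial.induction_on with
  | C a => simpa using hasDerivAt_const s a
  | add p q hp hq => simp only [map_add]; exact hp.add hq
  | mul_X p j hp =>
    have hX : HasDerivAt (fun s : ℝ => MvPolynomial.eval (y + Pi.single i s) (X j))
      (MvPolynomial.eval (y + Pi.single i s) (pderiv i (X j : MvPolynomial (Fin n) ℝ))) s := by
      by_cases h : j = i
      · subst h
        simpa using (hasDerivAt_id s).const_add (y j)
      · simpa [h, pderiv_X, Pi.single_apply] using hasDerivAt_const s (y j)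
    have := hp.mul hX
    simp only [Derivation.leibniz, map_mul, map_add, smul_eq_mul] at this ⊢
    refine this.congr_deriv ?_
    ring

lemma aux_cont {n : ℕ} (p : MvPolynomial (Fin n) ℝ) :
    Continuous (fun y : Fin n → ℝ => MvPolynomial.eval y p) := MvPolynomial.continuous_eval p

lemma aux_mvt0 (φ φ' : ℝ → ℝ) (h : ∀ s, HasDerivAt φ (φ' s) s) (s : ℝ) (hs : 0 < s) :
    ∃ u ∈ Set.Ioo 0 s, φ' u * s = φ s - φ 0 := by
  obtain ⟨u, hu, hu'⟩ := exists_hasDerivAt_eq_slope φ φ' hs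
    (fun s _ => (h s).continuousAt.continuousWithinAt) (fun s _ => h s)
  refine ⟨u, hu, ?_⟩
  rw [hu', sub_zero]
  field_simp

lemma aux_key {n : ℕ} (i : Fin n) (E : (Fin n → ℝ) → ℝ) (D : Fin n → (Fin n → ℝ) → ℝ)
    (hF : Continuous E) (hD : ∀ j, Continuous (D j))
    (hder : ∀ (j : Fin n) (y : Fin n → ℝ) (s : ℝ),
      HasDerivAt (fun s : ℝ => E (y + Pi.single j s)) (D j (y + Pi.single j s)) s)
    (x : Fin n → ℝ) (δ : ℝ) (hδ : 0 < δ)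
    (h0 : E x = 0)
    (hpos : ∀ y ∈ closedBall x δ, y ≠ x → 0 < E y)
    (hcrit : ∀ y ∈ closedBall x δ, (∀ j, j ≠ i → D j y = 0) →
      D i y = 0) : False := by
  obtain ⟨c, hc, hcA⟩ : ∃ c > 0, ∀ y ∈ closedBall x δ \ ball x (δ/2), c ≤ E y := by
    have hA : IsCompact (closedBall x δ \ ball x (δ/2)) :=
      (isCompact_closedBall x δ).diff isOpen_ball
    rcases (closedBall x δ \ ball x (δ/2)).eq_empty_or_nonempty with h | h
    · exact ⟨1, one_pos, by simp [h]⟩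
    · obtain ⟨z, hz, hm⟩ := hA.exists_isMinOn h hF.continuousOn
      refine ⟨_, hpos z hz.1 ?_, fun y hy => hm hy⟩
      rintro rfl
      exact hz.2 (mem_ball_self (by positivity))
  have hline : Continuous (fun s : ℝ => E (x + Pi.single i s)) :=
    continuous_iff_continuousAt.2 fun s => (hder i x s).continuousAt
  obtain ⟨t₀, ht₀, ht₀δ, ht₀c⟩ : ∃ t₀ > 0, t₀ ≤ δ/2 ∧ ∀ s, 0 ≤ s → s ≤ t₀ →
      E (x + Pi.single i s) < c := by
    have := (hline.continuousAt (x := 0)).eventually_lt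
      (continuousAt_const (y := c)) (by simpa [h0] using hc)
    obtain ⟨e, he, h⟩ := Metric.eventually_nhds_iff.1 this
    refine ⟨min (e/2) (δ/2), by positivity, min_le_right _ _, fun s hs hs' => h ?_⟩
    have := hs'.trans (min_le_left _ _)
    simp only [Real.dist_eq, sub_zero, abs_of_nonneg hs]
    linarith
  have hdist : ∀ (y : Fin n → ℝ) (j : Fin n) (s : ℝ), dist (y + Pi.single j s) y = |s| := by
    intro y j s
    simp [dist_eq_norm, Pi.norm_single]
  have hmin : ∀ t, ∃ y : Fin n → ℝ, 0 ≤ t → t ≤ t₀ → y ∈ ball x (δ/2) ∧ y i = x i + t ∧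
      ∀ z ∈ closedBall x δ, z i = x i + t → E y ≤ E z := by
    intro t
    by_cases ht : 0 ≤ t ∧ t ≤ t₀
    swap
    · exact ⟨x, fun h1 h2 => absurd ⟨h1, h2⟩ ht⟩
    have hK : IsCompact (closedBall x δ ∩ {z | z i = x i + t}) :=
      (isCompact_closedBall x δ).inter_right
        (isClosed_eq (continuous_apply i) continuous_const)
    have hmem : x + Pi.single i t ∈ closedBall x δ ∩ {z | z i = x i + t} := by
      refine ⟨?_, by simp⟩
      rw [mem_closedBall, hdist, abs_of_nonneg ht.1]
      linarith
    obtain ⟨y, hy, hm⟩ := hK.exists_isMinOn ⟨_, hmem⟩ hF.continuousOn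
    refine ⟨y, fun _ _ => ⟨?_, hy.2, fun z hz hz' => hm ⟨hz, hz'⟩⟩⟩
    by_contra hcon
    have h1 := hcA y ⟨hy.1, hcon⟩
    have h2 := ht₀c t ht.1 ht.2
    have h3 : E y ≤ E (x + Pi.single i t) := hm hmem
    linarith
  choose y hy using hmin
  have hsub : ball x (δ/2) ⊆ closedBall x δ :=
    (ball_subset_ball (by linarith)).trans ball_subset_closedBall
  have hyc : ∀ t, 0 ≤ t → t ≤ t₀ → D i (y t) = 0 := by
    intro t h1 h2
    obtain ⟨hb, hi, hm⟩ := hy t h1 h2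
    refine hcrit _ (hsub hb) fun j hj => ?_
    have hd := hder j (y t) 0
    have hloc : IsLocalMin (fun s : ℝ => E (y t + Pi.single j s)) 0 := by
      rw [mem_ball] at hb
      refine Metric.eventually_nhds_iff.2 ⟨δ/2, by positivity, fun s hs => ?_⟩
      simp only [Pi.single_zero, add_zero]
      refine hm _ ?_ (by simp [hi, hj.symm])
      have := dist_triangle (y t + Pi.single j s) (y t) x
      rw [hdist] at this
      rw [Real.dist_eq, sub_zero] at hs
      rw [mem_closedBall]
      linarith
    simpa using hloc.hasDerivAt_eq_zero hd
  have hend : 0 < E (y t₀) := by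
    obtain ⟨hb, hi, hm⟩ := hy t₀ ht₀.le le_rfl
    refine hpos _ (hsub hb) fun h => ?_
    rw [h] at hi
    linarith
  have hstart : E (y 0) ≤ 0 := by
    obtain ⟨hb, hi, hm⟩ := hy 0 le_rfl ht₀.le
    simpa [h0] using hm x (mem_closedBall_self hδ.le) (by simp)
  obtain ⟨ε, hε, hεt⟩ : ∃ ε > 0, ε * t₀ < E (y t₀) := by
    refine ⟨E (y t₀) / (2 * t₀), by positivity, ?_⟩
    field_simp
    linarith
  have huc := (isCompact_closedBall x δ).uniformContinuousOn_of_continuous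
    (hD i).continuousOn
  obtain ⟨η, hη, huc⟩ := Metric.uniformContinuousOn_iff.1 huc ε hε
  have hstep : ∀ t s, 0 ≤ t → 0 < s → s < η → t + s ≤ t₀ →
      E (y (t + s)) ≤ E (y t) + ε * s := by
    intro t s h1 h2 h3 h4
    obtain ⟨hb, hi, hm⟩ := hy t h1 (by linarith)
    have hball : ∀ u, 0 ≤ u → u ≤ s → y t + Pi.single i u ∈ closedBall x δ := by
      intro u hu hus
      have := dist_triangle (y t + Pi.single i u) (y t) x
      rw [hdist, abs_of_nonneg hu] at this
      rw [mem_ball] at hb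
      rw [mem_closedBall]
      linarith
    have hbs := hball s h2.le le_rfl
    have hts : 0 ≤ t + s := by linarith
    have hm' := (hy (t+s) hts h4).2.2
    have hco : (y t + (Pi.single i s : Fin n → ℝ)) i = x i + (t + s) := by
      rw [Pi.add_apply, Pi.single_eq_same, hi, add_assoc]
    have hle := hm' _ hbs hco
    obtain ⟨u, hu, hu'⟩ := aux_mvt0 _ _ (hder i (y t)) s h2
    have hd := huc _ (hball u hu.1.le hu.2.le) (y t) (hsub hb)
      (by rw [hdist, abs_of_nonneg hu.1.le]; linarith [hu.2])
    rw [hyc t h1 (by linarith), Real.dist_eq, sub_zero] at hd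
    have hd' := (le_abs_self _).trans hd.le
    have hd2 := mul_le_mul_of_nonneg_right hd' h2.le
    rw [hu', Pi.single_zero, add_zero] at hd2
    linarith
  obtain ⟨N, hN⟩ := exists_nat_gt (t₀ / η)
  have hNpos : (0:ℝ) < N := lt_trans (by positivity) hN
  have hind : ∀ k : ℕ, k ≤ N →
      E (y (k * (t₀ / N))) ≤ ε * (k * (t₀ / N)) := by
    intro k
    induction k with
    | zero => intro _; simpa using hstart
    | succ k ih =>
      intro hk
      have h1 := ih (by omega)
      have hk' : ((k:ℝ) + 1) ≤ N := by exact_mod_cast hk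
      have h2 := hstep (k * (t₀ / N)) (t₀ / N) (by positivity) (by positivity)
        (by rw [div_lt_iff₀ hη] at hN; rw [div_lt_iff₀ hNpos]; linarith)
        (by
          calc (k:ℝ) * (t₀ / N) + t₀ / N = (k + 1) * (t₀ / N) := by ring
            _ ≤ N * (t₀ / N) := by gcongr
            _ = t₀ := by field_simp)
      have e : (((k + 1 : ℕ) : ℝ)) * (t₀ / N) = k * (t₀ / N) + t₀ / N := by push_cast; ring
      rw [e]
      linarith
  have := hind N le_rfl
  rw [mul_div_cancel₀ _ hNpos.ne'] at this
  linarith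



/-- Every isolated point of `H(f)` is a common real zero of the
ideal `⟨f⟩ + Σᵢ (Iᵢ ∩ ℝ[x₁,…,xₙ])`, where `Iᵢ ⊆ ℝ[x₁,…,xₙ,ℓ]` is generated by
`ℓ·∂f/∂xᵢ − 1` and the `∂f/∂x_j` for `j ≠ i`.  Here `ℝ[x₁,…,xₙ,ℓ]` is modelled
as `MvPolynomial (Option (Fin n)) ℝ` with `ℓ = X none`, the embedding
`ℝ[x₁,…,xₙ] ↪ ℝ[x₁,…,xₙ,ℓ]` is `rename some`, and the elimination ideal
`Iᵢ ∩ ℝ[x₁,…,xₙ]` is the preimage of `Iᵢ` under this embedding. -/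
theorem isolated_vanish_on_elimination_ideal
    (n : ℕ) (hn : 1 ≤ n) (f : MvPolynomial (Fin n) ℝ)
    (H : Set (EuclideanSpace ℝ (Fin n)))
    (hH : H = {y : EuclideanSpace ℝ (Fin n) | MvPolynomial.eval y f = 0})
    (I : Fin n → Ideal (MvPolynomial (Option (Fin n)) ℝ))
    (hI : ∀ i : Fin n, I i = Ideal.span
      (insert (X none * rename (Option.some) (pderiv i f) - 1)
        ((fun j : Fin n => rename (Option.some) (pderiv j f)) '' {j | j ≠ i})))
    (J : Ideal (MvPolynomial (Fin n) ℝ))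
    (hJ : J = Ideal.span {f} +
      ∑ i : Fin n, Ideal.comap (rename (Option.some : Fin n → Option (Fin n))
        : MvPolynomial (Fin n) ℝ →ₐ[ℝ] MvPolynomial (Option (Fin n)) ℝ).toRingHom (I i))
    (x : EuclideanSpace ℝ (Fin n)) (hx : x ∈ H)
    (hiso : ∃ r > 0, Metric.ball x r ∩ H = {x}) :
    (∀ i : Fin n, ∀ g : MvPolynomial (Fin n) ℝ,
        rename (Option.some) g ∈ I i → MvPolynomial.eval x g = 0) ∧
    (∀ g ∈ J, MvPolynomial.eval x g = 0) := by

  have hmain : ∀ i : Fin n, ∀ g : MvPolynomial (Fin n) ℝ,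
        rename (Option.some) g ∈ I i → MvPolynomial.eval x g = 0 := by
    intro i g hg
    by_contra hgx
    obtain ⟨r, hr, hball⟩ := hiso
    subst hH
    have hx0 : MvPolynomial.eval (x : Fin n → ℝ) f = 0 := hx
    have hev1 : ∀ᶠ y : Fin n → ℝ in nhds (x : Fin n → ℝ), MvPolynomial.eval y g ≠ 0 :=
      (aux_cont g).continuousAt.eventually_ne hgx
    have hev2 : ∀ᶠ y : Fin n → ℝ in nhds (x : Fin n → ℝ), y ≠ x → MvPolynomial.eval y f ≠ 0 := by
      have hc : Continuous (fun y : Fin n → ℝ => (WithLp.toLp 2 y : EuclideanSpace ℝ (Fin n))) :=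
        PiLp.continuous_toLp 2 _
      have := (hc.continuousAt (x := (x : Fin n → ℝ))).eventually (p := fun z => z ∈ ball x r)
        (ball_mem_nhds x hr)
      filter_upwards [this] with y hy hne h0
      have : (WithLp.toLp 2 y : EuclideanSpace ℝ (Fin n)) ∈ ({x} : Set _) := by
        rw [← hball]; exact ⟨hy, h0⟩
      apply hne
      rw [Set.mem_singleton_iff] at this
      rw [← this]
    obtain ⟨δ, hδ, hb⟩ := Metric.nhds_basis_closedBall.mem_iff.1 (hev1.and hev2)
    refine aux_key i (fun y => MvPolynomial.eval y (f ^ 2))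
      (fun j y => MvPolynomial.eval y (pderiv j (f ^ 2))) (aux_cont _) (fun j => aux_cont _)
      (fun j y s => aux_hasDerivAt j y _ s) (x : Fin n → ℝ) δ hδ (by simp [hx0]) ?_ ?_
    · intro y hy hne
      have := (hb hy).2 hne
      rw [map_pow]
      positivity
    · intro y hy hj
      by_contra hi
      have hpd : ∀ j, MvPolynomial.eval y (pderiv j (f ^ 2)) =
          2 * MvPolynomial.eval y f * MvPolynomial.eval y (pderiv j f) := by
        intro j
        simp [pow_two, Derivation.leibniz]
        ring
      rw [hpd] at hi
      have hf : MvPolynomial.eval y f ≠ 0 := fun h => hi (by simp [h])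
      have hfi : MvPolynomial.eval y (pderiv i f) ≠ 0 := fun h => hi (by simp [h])
      have hfj : ∀ j, j ≠ i → MvPolynomial.eval y (pderiv j f) = 0 := by
        intro j hji
        have := hj j hji
        rw [hpd] at this
        simpa [hf] using this
      let v : Option (Fin n) → ℝ := fun o => o.elim (MvPolynomial.eval y (pderiv i f))⁻¹ y
      have hv : ∀ p : MvPolynomial (Fin n) ℝ,
          MvPolynomial.eval v (rename Option.some p) = MvPolynomial.eval y p := by
        intro p
        rw [eval_rename]
        rfl
      have hle : I i ≤ RingHom.ker (MvPolynomial.eval v) := by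
        rw [hI, Ideal.span_le]
        rintro p (rfl | ⟨j, hji, rfl⟩)
        · simp only [SetLike.mem_coe, RingHom.mem_ker, map_sub, map_mul, hv, eval_X, map_one]
          simp [v, hfi]
        · simp only [SetLike.mem_coe, RingHom.mem_ker, hv]
          exact hfj j hji
      have := hle hg
      rw [RingHom.mem_ker, hv] at this
      exact (hb hy).1 this
  refine ⟨hmain, ?_⟩
  have hle : J ≤ RingHom.ker (MvPolynomial.eval (x : Fin n → ℝ)) := by
    rw [hJ, Ideal.add_eq_sup, sup_le_iff]
    constructor
    · rw [Ideal.span_le, Set.singleton_subset_iff]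
      rw [hH] at hx
      exact hx
    · rw [Ideal.sum_eq_sup]
      refine Finset.sup_le fun i _ p hp => ?_
      exact hmain i p hp
  exact fun g hg => hle hg
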